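/- In the abstract setting, assume (Ω^•, d) is exact in positive degrees, let p ≥ 2 and let k ∈ ℕ. If x ∈ K^p ∩ ker d is such that H^p(u)[x] ∈ b^k(ℰ^p), then [x] ∈ b^k(E^p) (where b denotes the induced endomorphism of E^p). -/

import Mathlib

/-! Abstract setting for the paper's relative Brieskorn complexes.

`Ω` is a cochain complex of `R`-modules, graded by `ℤ` and vanishing in
negative degrees (this encodes the paper's conventions `Ω^p` for `p ∈ ℕ`,
`K^{-1} := 0`, `I^0 := 0`, `𝒦^{-1} := 0`), with two anticommuting
differentials `d` (the relative de Rham differential) and `e` (exterior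
multiplication by `d_{/S} f`). -/

section AbstractSetting

variable {R : Type*} [CommRing R] {Ω : ℤ → Type*}
  [∀ i, AddCommGroup (Ω i)] [∀ i, Module R (Ω i)]

/-- The space `𝒦^p` of formal series `Σ_j b^j ω_j` with `e(ω_0) = 0`,
as a submodule of the module of sequences `ℕ → Ω p`. -/
def KSeq (e : ∀ i : ℤ, Ω i →ₗ[R] Ω (i + 1)) (p : ℤ) :
    Submodule R (ℕ → Ω p) where
  carrier := {ω | e p (ω 0) = 0}
  add_mem' := by
    intro x y hx hy
    simp only [Set.mem_setOf_eq, Pi.add_apply, map_add] at *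
    rw [hx, hy, add_zero]
  zero_mem' := by simp
  smul_mem' := by
    intro c x hx
    simp only [Set.mem_setOf_eq, Pi.smul_apply, map_smul] at *
    rw [hx, smul_zero]

/-- The differential `D` on sequences: `(D ω)_j = d(ω_j) - e(ω_{j+1})`. -/
def Dop (d e : ∀ i : ℤ, Ω i →ₗ[R] Ω (i + 1)) (p : ℤ) :
    (ℕ → Ω p) →ₗ[R] (ℕ → Ω (p + 1)) where
  toFun ω := fun j => d p (ω j) - e p (ω (j + 1))
  map_add' x y := by
    funext j
    simp only [Pi.add_apply, map_add]
    abel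
  map_smul' c x := by
    funext j
    simp only [Pi.smul_apply, map_smul, RingHom.id_apply, smul_sub]

/-- The shift operator `b` on sequences: `(b ω)_0 = 0`, `(b ω)_j = ω_{j-1}`. -/
def bShift {p : ℤ} (ω : ℕ → Ω p) : ℕ → Ω p
  | 0 => 0
  | (k + 1) => ω k

/-- The sequence `(x, 0, 0, …)`, i.e. the chain map `u : K^p → 𝒦^p`. -/
def unitSeq {p : ℤ} (x : Ω p) : ℕ → Ω p
  | 0 => x
  | (_ + 1) => 0

/-- The submodule of finitely supported sequences (`𝒦^{0,p}` inside `𝒦^p`). -/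
def finSuppSeq (p : ℤ) : Submodule R (ℕ → Ω p) where
  carrier := {ω | ∃ N : ℕ, ∀ j : ℕ, N ≤ j → ω j = 0}
  add_mem' := by
    rintro x y ⟨Nx, hx⟩ ⟨Ny, hy⟩
    exact ⟨max Nx Ny, fun j hj => by
      simp [hx j (le_trans (le_max_left _ _) hj), hy j (le_trans (le_max_right _ _) hj)]⟩
  zero_mem' := ⟨0, fun j _ => rfl⟩
  smul_mem' := by
    rintro c x ⟨Nx, hx⟩
    exact ⟨Nx, fun j hj => by simp [hx j hj]⟩

/-- The cocycles `Z^p = K^p ∩ ker d` of the complex `(K^•, d)`. -/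
def Zmod (d e : ∀ i : ℤ, Ω i →ₗ[R] Ω (i + 1)) (p : ℤ) : Submodule R (Ω p) :=
  LinearMap.ker (e p) ⊓ LinearMap.ker (d p)

/-- The coboundaries `d(K^{p-1})` of the complex `(K^•, d)` (in degree `q+1`). -/
def Bmod (d e : ∀ i : ℤ, Ω i →ₗ[R] Ω (i + 1)) (q : ℤ) : Submodule R (Ω (q + 1)) :=
  Submodule.map (d q) (LinearMap.ker (e q))

/-- The cohomology `E^{q+1} = (K^{q+1} ∩ ker d) / d(K^q)`. -/
abbrev Emod (d e : ∀ i : ℤ, Ω i →ₗ[R] Ω (i + 1)) (q : ℤ) :=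
  Zmod d e (q + 1) ⧸ Submodule.comap (Zmod d e (q + 1)).subtype (Bmod d e q)

/-- The `D`-cocycles in `𝒦^p`. -/
def ZSeq (d e : ∀ i : ℤ, Ω i →ₗ[R] Ω (i + 1)) (p : ℤ) : Submodule R (ℕ → Ω p) :=
  KSeq e p ⊓ LinearMap.ker (Dop d e p)

/-- The `D`-coboundaries `D(𝒦^q)` in degree `q+1`. -/
def BSeq (d e : ∀ i : ℤ, Ω i →ₗ[R] Ω (i + 1)) (q : ℤ) : Submodule R (ℕ → Ω (q + 1)) :=
  Submodule.map (Dop d e q) (KSeq e q)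

/-- The cohomology `ℰ^{q+1} = ker(D : 𝒦^{q+1} → 𝒦^{q+2}) / D(𝒦^q)`. -/
abbrev ESeq (d e : ∀ i : ℤ, Ω i →ₗ[R] Ω (i + 1)) (q : ℤ) :=
  ZSeq d e (q + 1) ⧸ Submodule.comap (ZSeq d e (q + 1)).subtype (BSeq d e q)

end AbstractSetting

section Auxiliary

variable {R : Type*} [CommRing R] {Ω : ℤ → Type*}
  [∀ i, AddCommGroup (Ω i)] [∀ i, Module R (Ω i)]

theorem mem_ZSeq_iff {d e : ∀ i : ℤ, Ω i →ₗ[R] Ω (i + 1)} {p : ℤ} {ω : ℕ → Ω p} :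
    ω ∈ ZSeq d e p ↔ e p (ω 0) = 0 ∧ ∀ j, d p (ω j) - e p (ω (j + 1)) = 0 := by
  refine and_congr Iff.rfl ?_
  exact LinearMap.mem_ker.trans funext_iff

theorem mem_Zmod_iff {d e : ∀ i : ℤ, Ω i →ₗ[R] Ω (i + 1)} {p : ℤ} {x : Ω p} :
    x ∈ Zmod d e p ↔ e p x = 0 ∧ d p x = 0 := Iff.rfl

theorem bShift_mem_ZSeq {d e : ∀ i : ℤ, Ω i →ₗ[R] Ω (i + 1)} {p : ℤ} {ω : ℕ → Ω p}
    (hω : ω ∈ ZSeq d e p) : bShift ω ∈ ZSeq d e p := by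
  rw [mem_ZSeq_iff] at hω ⊢
  refine ⟨by simp [bShift], fun j => ?_⟩
  cases j with
  | zero => simp [bShift, hω.1]
  | succ j => exact hω.2 j

theorem unitSeq_mem_ZSeq {d e : ∀ i : ℤ, Ω i →ₗ[R] Ω (i + 1)} {p : ℤ} {x : Ω p}
    (hx : x ∈ Zmod d e p) : unitSeq x ∈ ZSeq d e p := by
  rw [mem_Zmod_iff] at hx
  rw [mem_ZSeq_iff]
  refine ⟨hx.1, fun j => ?_⟩
  cases j with
  | zero => simp [unitSeq, hx.2]
  | succ j => simp [unitSeq]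

/-- A class in the image of the `k`-th power of the shift has a representative whose first
`k` coefficients vanish. -/
theorem exists_rep_of_shift_pow {d e : ∀ i : ℤ, Ω i →ₗ[R] Ω (i + 1)} {q : ℤ}
    {b : Module.End R (ESeq d e q)}
    (hb : ∀ (X : ℕ → Ω (q + 1)) (hX : X ∈ ZSeq d e (q + 1))
        (hbX : bShift X ∈ ZSeq d e (q + 1)),
      b (Submodule.Quotient.mk ⟨X, hX⟩) = Submodule.Quotient.mk ⟨bShift X, hbX⟩)
    (k : ℕ) (w : ESeq d e q) :
    ∃ (X : ℕ → Ω (q + 1)) (hX : X ∈ ZSeq d e (q + 1)),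
      (∀ j < k, X j = 0) ∧ (b ^ k) w = Submodule.Quotient.mk ⟨X, hX⟩ := by
  induction k with
  | zero =>
    obtain ⟨⟨X, hX⟩, rfl⟩ := Submodule.Quotient.mk_surjective _ w
    exact ⟨X, hX, by simp, by simp⟩
  | succ k ih =>
    obtain ⟨X, hX, hX0, hXw⟩ := ih
    refine ⟨bShift X, bShift_mem_ZSeq hX, fun j hj => ?_, ?_⟩
    · cases j with
      | zero => rfl
      | succ j => exact hX0 j (by omega)
    · rw [pow_succ', Module.End.mul_apply, hXw, hb]

/-- If `d ζ_j = e ζ_{j+1}` for `j + 1 < k`, then the class of `e ζ_0` is `b` applied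
`k` times to the class of `d ζ_{k-1}`. -/
theorem mk_mem_range_pow_of_chain {d e : ∀ i : ℤ, Ω i →ₗ[R] Ω (i + 1)} {q : ℤ}
    (hdd : ∀ (i : ℤ) (x : Ω i), d (i + 1) (d i x) = 0)
    (hde : ∀ (i : ℤ) (x : Ω i), d (i + 1) (e i x) = - e (i + 1) (d i x))
    {b : Module.End R (Emod d e q)}
    (hb : ∀ (x : Ω (q + 1)) (hx : x ∈ Zmod d e (q + 1)) (ξ : Ω q)
        (_ : d q ξ = x) (he : e q ξ ∈ Zmod d e (q + 1)),
      b (Submodule.Quotient.mk ⟨x, hx⟩) = Submodule.Quotient.mk ⟨e q ξ, he⟩)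
    (k : ℕ) (ζ : ℕ → Ω q) (hζ : ∀ j, j + 1 < k → d q (ζ j) = e q (ζ (j + 1)))
    (h0 : e q (ζ 0) ∈ Zmod d e (q + 1)) :
    (Submodule.Quotient.mk ⟨e q (ζ 0), h0⟩ : Emod d e q) ∈ LinearMap.range (b ^ k) := by
  induction k generalizing ζ with
  | zero => exact ⟨_, by rw [pow_zero, Module.End.one_apply]⟩
  | succ k ih =>
    have hd : d q (ζ 0) ∈ Zmod d e (q + 1) := by
      refine mem_Zmod_iff.2 ⟨?_, hdd _ _⟩
      rw [← neg_eq_zero, ← hde]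
      exact (mem_Zmod_iff.1 h0).2
    suffices h : (Submodule.Quotient.mk ⟨d q (ζ 0), hd⟩ : Emod d e q) ∈
        LinearMap.range (b ^ k) by
      obtain ⟨v, hv⟩ := h
      exact ⟨v, by rw [pow_succ', Module.End.mul_apply, hv, hb _ hd _ rfl h0]⟩
    cases k with
    | zero => exact ⟨_, by rw [pow_zero, Module.End.one_apply]⟩
    | succ k =>
      have h01 := hζ 0 (by omega)
      have h1 : e q (ζ 1) ∈ Zmod d e (q + 1) := h01 ▸ hd
      have := ih (fun j => ζ (j + 1)) (fun j hj => hζ (j + 1) (by omega)) h1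
      simpa only [h01] using this

end Auxiliary

/-- paper's Lemma "b-filt.": the `b`-filtration on `E^p` is
induced by the `b`-filtration on `ℰ^p`.  Assume `(Ω^•, d)` is exact in
positive degrees and `p ≥ 2` (here `p = r + 2` with `r ≥ 0`).  If
`x ∈ K^p ∩ ker d` and `H^p(u)[x] ∈ b^k(ℰ^p)`, then `[x] ∈ b^k(E^p)`. -/
theorem brieskorn_b_filtration_induced
    {R : Type*} [CommRing R] {Ω : ℤ → Type*}
    [∀ i, AddCommGroup (Ω i)] [∀ i, Module R (Ω i)]
    (hneg : ∀ i : ℤ, i < 0 → Subsingleton (Ω i))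
    (d e : ∀ i : ℤ, Ω i →ₗ[R] Ω (i + 1))
    (hdd : ∀ (i : ℤ) (x : Ω i), d (i + 1) (d i x) = 0)
    (hee : ∀ (i : ℤ) (x : Ω i), e (i + 1) (e i x) = 0)
    (hde : ∀ (i : ℤ) (x : Ω i), d (i + 1) (e i x) = - e (i + 1) (d i x))
    (hex : ∀ i : ℤ, 0 ≤ i → ∀ y : Ω (i + 1), d (i + 1) y = 0 →
      ∃ x : Ω i, d i x = y)
    (r : ℤ) (hr : 0 ≤ r) (k : ℕ)
    -- the action of `b` on `E^p`
    (bE : Module.End R (Emod d e (r + 1)))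
    (hbE : ∀ (x : Ω (r + 1 + 1)) (hx : x ∈ Zmod d e (r + 1 + 1)) (ξ : Ω (r + 1))
        (hξ : d (r + 1) ξ = x) (he : e (r + 1) ξ ∈ Zmod d e (r + 1 + 1)),
      bE (Submodule.Quotient.mk ⟨x, hx⟩) =
        Submodule.Quotient.mk ⟨e (r + 1) ξ, he⟩)
    -- the shift-induced action of `b` on `ℰ^p`
    (bcalE : Module.End R (ESeq d e (r + 1)))
    (hbcalE : ∀ (X : ℕ → Ω (r + 1 + 1)) (hX : X ∈ ZSeq d e (r + 1 + 1))
        (hb : bShift X ∈ ZSeq d e (r + 1 + 1)),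
      bcalE (Submodule.Quotient.mk ⟨X, hX⟩) =
        Submodule.Quotient.mk ⟨bShift X, hb⟩)
    -- the map `H^p(u) : E^p → ℰ^p` induced by `u : x ↦ (x,0,0,…)`
    (Hu : Emod d e (r + 1) →ₗ[R] ESeq d e (r + 1))
    (hHu : ∀ (x : Ω (r + 1 + 1)) (hx : x ∈ Zmod d e (r + 1 + 1))
        (hu : unitSeq x ∈ ZSeq d e (r + 1 + 1)),
      Hu (Submodule.Quotient.mk ⟨x, hx⟩) =
        Submodule.Quotient.mk ⟨unitSeq x, hu⟩) :
    ∀ (x : Ω (r + 1 + 1)) (hx : x ∈ Zmod d e (r + 1 + 1)),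
      Hu (Submodule.Quotient.mk ⟨x, hx⟩) ∈ LinearMap.range (bcalE ^ k) →
      (Submodule.Quotient.mk ⟨x, hx⟩ : Emod d e (r + 1)) ∈
        LinearMap.range (bE ^ k) := by
  intro x hx ⟨w, hw⟩
  cases k with
  | zero => exact ⟨_, by rw [pow_zero, Module.End.one_apply]⟩
  | succ k =>
    obtain ⟨X, hX, hX0, hXw⟩ := exists_rep_of_shift_pow hbcalE (k + 1) w
    rw [hXw, hHu x hx (unitSeq_mem_ZSeq hx), Submodule.Quotient.eq] at hw
    obtain ⟨η, hη, hDη⟩ := hw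
    have hη0 : e (r + 1) (η 0) = 0 := hη
    have hcoef : ∀ j, d (r + 1) (η j) - e (r + 1) (η (j + 1)) = X j - unitSeq x j :=
      fun j => congrFun hDη j
    have hx0 : x = e (r + 1) (η 1) - d (r + 1) (η 0) := by
      have h := hcoef 0
      rw [hX0 0 (by omega)] at h
      simp only [unitSeq, zero_add, zero_sub] at h
      rw [← neg_sub, h, neg_neg]
    have hdη : d (r + 1) (η 0) ∈ Zmod d e (r + 1 + 1) := by
      refine mem_Zmod_iff.2 ⟨?_, hdd _ _⟩
      rw [← neg_eq_zero, ← hde, hη0, map_zero]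
    have he1 : e (r + 1) (η 1) ∈ Zmod d e (r + 1 + 1) := by
      have h := add_mem hx hdη
      rwa [hx0, sub_add_cancel] at h
    have hmk : (Submodule.Quotient.mk ⟨x, hx⟩ : Emod d e (r + 1)) =
        Submodule.Quotient.mk ⟨e (r + 1) (η 1), he1⟩ := by
      rw [Submodule.Quotient.eq]
      refine ⟨-η 0, by simp [hη0], ?_⟩
      simp [hx0]
    rw [hmk]
    refine mk_mem_range_pow_of_chain hdd hde hbE (k + 1) (fun j => η (j + 1))
      (fun j hj => ?_) he1
    have h := hcoef (j + 1)
    rw [hX0 (j + 1) hj] at h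
    simpa [unitSeq, sub_eq_zero] using h
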